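/- Division algorithm by f(c): let f ∈ F with n := natDegree f. For every β ∈ R there exist a unique q ∈ R and a unique r ∈ G^f (the K-linear span of {c^i : 0 ≤ i ≤ n-1}) such that β = q * f(c) + r. -/

import Mathlib

noncomputable section

/-- The defining relation `X * Y = 1` of the Jacobson algebra. -/
inductive JRel (K : Type*) [Field K] : FreeAlgebra K (Fin 2) → FreeAlgebra K (Fin 2) → Prop
  | rel : JRel K (FreeAlgebra.ι K 0 * FreeAlgebra.ι K 1) 1

/-- The Jacobson algebra `K⟨X, Y | XY = 1⟩`. -/
abbrev Jacobson (K : Type*) [Field K] := RingQuot (JRel K)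

variable (K : Type*) [Field K]

/-- The generator `X` of the Jacobson algebra. -/
def Xg : Jacobson K := RingQuot.mkAlgHom K (JRel K) (FreeAlgebra.ι K 0)

/-- The generator `Y` of the Jacobson algebra. -/
def Yg : Jacobson K := RingQuot.mkAlgHom K (JRel K) (FreeAlgebra.ι K 1)

/-- The loop `c = Y²X`. -/
def cJ : Jacobson K := Yg K ^ 2 * Xg K

/-- `F` is the set of irreducible polynomials `f ∈ K[x]` with `f(0) = -1`. -/
def FSet : Set (Polynomial K) := {f | Irreducible f ∧ f.eval 0 = -1}

/-- `G^f`: the `K`-linear span of `{c^i : 0 ≤ i ≤ n - 1}` in the Jacobson algebra,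
where `n` is the degree of `f`. -/
def Gf (n : ℕ) : Submodule K (Jacobson K) :=
  Submodule.span K (Set.range fun i : Fin n => cJ K ^ (i : ℕ))

theorem xy_eq : Xg K * Yg K = 1 := by
  unfold Xg Yg
  rw [← map_mul, RingQuot.mkAlgHom_rel K (JRel.rel (K := K)), map_one]

theorem cy_eq : cJ K * Yg K = Yg K * Yg K := by
  unfold cJ; rw [mul_assoc, xy_eq, mul_one, sq]

theorem yc_eq : Yg K * cJ K = cJ K * cJ K := by
  have h := cy_eq K
  calc Yg K * cJ K = (Yg K * Yg K) * Yg K * Xg K := by unfold cJ; noncomm_ring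
    _ = cJ K * (Yg K * Yg K) * Xg K := by rw [← h, mul_assoc (cJ K), ← h]
    _ = cJ K * cJ K := by unfold cJ; noncomm_ring

theorem xc_eq : Xg K * cJ K = Yg K * Xg K := by
  unfold cJ
  rw [sq, mul_assoc, ← mul_assoc, xy_eq, one_mul]

theorem yxc_eq : Yg K * Xg K * cJ K = cJ K := by
  rw [mul_assoc, xc_eq]; unfold cJ; noncomm_ring

theorem pc_y (p : Polynomial K) :
    Polynomial.aeval (cJ K) p * Yg K = Yg K * Polynomial.aeval (Yg K) p := by
  induction p using Polynomial.induction_on' with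
  | add p q hp hq => simp only [map_add, add_mul, mul_add, hp, hq]
  | monomial n a =>
    have h : SemiconjBy (Yg K) (Yg K) (cJ K) := (cy_eq K).symm
    have h2 := (h.pow_right n).eq
    simp only [Polynomial.aeval_monomial]
    rw [mul_assoc, ← h2, ← mul_assoc, ← mul_assoc, Algebra.commutes]

theorem split_p (p : Polynomial K) : ∃ (g : Polynomial K), p = Polynomial.X * g + Polynomial.C (p.eval 0) := by
  refine ⟨p.divX, ?_⟩
  conv_lhs => rw [← Polynomial.X_mul_divX_add p]
  rw [Polynomial.coeff_zero_eq_eval_zero]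

/-- Elements congruent to a polynomial in `c` modulo the left ideal of `f(c)`. -/
def MM (f : Polynomial K) : Submodule K (Jacobson K) where
  carrier := {b | ∃ (q : Jacobson K) (p : Polynomial K), b = q * Polynomial.aeval (cJ K) f + Polynomial.aeval (cJ K) p}
  zero_mem' := ⟨0, 0, by simp⟩
  add_mem' := by
    rintro a b ⟨q, p, rfl⟩ ⟨q', p', rfl⟩
    exact ⟨q + q', p + p', by rw [map_add, add_mul]; abel⟩
  smul_mem' := by
    rintro a b ⟨q, p, rfl⟩
    exact ⟨a • q, a • p, by rw [map_smul, smul_mul_assoc, smul_add]⟩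

theorem MM_l (f : Polynomial K) (q : Jacobson K) : q * Polynomial.aeval (cJ K) f ∈ MM K f :=
  ⟨q, 0, by simp⟩

theorem MM_p (f p : Polynomial K) : Polynomial.aeval (cJ K) p ∈ MM K f :=
  ⟨0, p, by simp⟩

theorem split_pc (p : Polynomial K) : ∃ g : Polynomial K, Polynomial.aeval (cJ K) p =
    cJ K * Polynomial.aeval (cJ K) g + algebraMap K _ (p.eval 0) := by
  obtain ⟨g, hg⟩ := split_p K p
  refine ⟨g, ?_⟩
  conv_lhs => rw [hg]
  simp

theorem split_f (f : Polynomial K) (hf : f.eval 0 = -1) : ∃ g : Polynomial K,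
    f = Polynomial.X * g - 1 ∧
    Polynomial.aeval (cJ K) f = cJ K * Polynomial.aeval (cJ K) g - 1 := by
  obtain ⟨g, hg⟩ := split_p K f
  rw [hf] at hg
  have : f = Polynomial.X * g - 1 := by rw [hg]; simp; ring
  exact ⟨g, this, by rw [this]; simp⟩

theorem MM_y (f : Polynomial K) (hf : f.eval 0 = -1) (p : Polynomial K) :
    Yg K * Polynomial.aeval (cJ K) p ∈ MM K f := by
  obtain ⟨g, -, hg⟩ := split_f K f hf
  obtain ⟨p', hp⟩ := split_pc K p
  have hc : ∀ s : Polynomial K, Yg K * (cJ K * Polynomial.aeval (cJ K) s) ∈ MM K f := by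
    intro s
    have := MM_p K f (Polynomial.X * (Polynomial.X * s))
    rw [← mul_assoc, yc_eq, mul_assoc]
    simpa using this
  have hy : Yg K ∈ MM K f := by
    have := (MM K f).sub_mem (hc g) (MM_l K f (Yg K))
    rw [hg] at this
    rwa [mul_sub, mul_one, sub_sub_cancel] at this
  rw [hp, mul_add, ← Algebra.commutes, ← Algebra.smul_def]
  exact (MM K f).add_mem (hc p') ((MM K f).smul_mem _ hy)

theorem MM_yx (f : Polynomial K) (hf : f.eval 0 = -1) (p : Polynomial K) :
    Yg K * Xg K * Polynomial.aeval (cJ K) p ∈ MM K f := by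
  obtain ⟨g, -, hg⟩ := split_f K f hf
  obtain ⟨p', hp⟩ := split_pc K p
  have hc : ∀ s : Polynomial K, Yg K * Xg K * (cJ K * Polynomial.aeval (cJ K) s) ∈ MM K f := by
    intro s
    have := MM_p K f (Polynomial.X * s)
    rw [← mul_assoc, yxc_eq]
    simpa using this
  have hy : Yg K * Xg K ∈ MM K f := by
    have := (MM K f).sub_mem (hc g) (MM_l K f (Yg K * Xg K))
    rw [hg] at this
    rwa [mul_sub, mul_one, sub_sub_cancel] at this
  rw [hp, mul_add, ← Algebra.commutes, ← Algebra.smul_def]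
  exact (MM K f).add_mem (hc p') ((MM K f).smul_mem _ hy)

theorem MM_x (f : Polynomial K) (hf : f.eval 0 = -1) (p : Polynomial K) :
    Xg K * Polynomial.aeval (cJ K) p ∈ MM K f := by
  obtain ⟨g, -, hg⟩ := split_f K f hf
  obtain ⟨p', hp⟩ := split_pc K p
  have hc : ∀ s : Polynomial K, Xg K * (cJ K * Polynomial.aeval (cJ K) s) ∈ MM K f := by
    intro s
    rw [← mul_assoc, xc_eq]
    exact MM_yx K f hf s
  have hy : Xg K ∈ MM K f := by
    have := (MM K f).sub_mem (hc g) (MM_l K f (Xg K))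
    rw [hg] at this
    rwa [mul_sub, mul_one, sub_sub_cancel] at this
  rw [hp, mul_add, ← Algebra.commutes, ← Algebra.smul_def]
  exact (MM K f).add_mem (hc p') ((MM K f).smul_mem _ hy)

theorem J_induction {P : Jacobson K → Prop} (hk : ∀ a, P (algebraMap K _ a))
    (hx : P (Xg K)) (hy : P (Yg K)) (hm : ∀ a b, P a → P b → P (a * b))
    (ha : ∀ a b, P a → P b → P (a + b)) (b : Jacobson K) : P b := by
  obtain ⟨b, rfl⟩ := RingQuot.mkAlgHom_surjective K (JRel K) b
  induction b using FreeAlgebra.induction with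
  | grade0 r => rw [AlgHom.commutes]; exact hk r
  | grade1 i => fin_cases i; exacts [hx, hy]
  | mul a b h1 h2 => rw [map_mul]; exact hm _ _ h1 h2
  | add a b h1 h2 => rw [map_add]; exact ha _ _ h1 h2

theorem MM_top (f : Polynomial K) (hf : f.eval 0 = -1) (b : Jacobson K) : b ∈ MM K f := by
  have key : ∀ b : Jacobson K, ∀ m ∈ MM K f, b * m ∈ MM K f := by
    intro b
    induction b using J_induction with
    | hk a => intro m hm; rw [← Algebra.smul_def]; exact (MM K f).smul_mem _ hm
    | hx =>
      rintro m ⟨q, p, rfl⟩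
      rw [mul_add, ← mul_assoc]
      exact (MM K f).add_mem (MM_l K f _) (MM_x K f hf p)
    | hy =>
      rintro m ⟨q, p, rfl⟩
      rw [mul_add, ← mul_assoc]
      exact (MM K f).add_mem (MM_l K f _) (MM_y K f hf p)
    | hm a b h1 h2 => intro m hm; rw [mul_assoc]; exact h1 _ (h2 _ hm)
    | ha a b h1 h2 => intro m hm; rw [add_mul]; exact (MM K f).add_mem (h1 _ hm) (h2 _ hm)
  have := key b 1 (by simpa using MM_p K f 1)
  simpa using this

theorem exists_Ym (q : Jacobson K) :
    ∃ m : ℕ, ∃ p : Polynomial K, q * Yg K ^ m = Polynomial.aeval (Yg K) p := by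
  induction q using J_induction with
  | hk a => exact ⟨0, Polynomial.C a, by simp⟩
  | hx => exact ⟨1, 1, by simp [xy_eq]⟩
  | hy => exact ⟨0, Polynomial.X, by simp⟩
  | hm a b h1 h2 =>
    obtain ⟨m, p, h1⟩ := h1
    obtain ⟨k, s, h2⟩ := h2
    refine ⟨k + m, p * s, ?_⟩
    have hc : Polynomial.aeval (Yg K) s * Yg K ^ m = Yg K ^ m * Polynomial.aeval (Yg K) s := by
      have : Polynomial.aeval (Yg K) (s * Polynomial.X ^ m) =
        Polynomial.aeval (Yg K) (Polynomial.X ^ m * s) := by rw [mul_comm]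
      simpa using this
    rw [pow_add, mul_assoc, ← mul_assoc b, h2, hc, ← mul_assoc, h1, map_mul]
  | ha a b h1 h2 =>
    obtain ⟨m, p, h1⟩ := h1
    obtain ⟨k, s, h2⟩ := h2
    refine ⟨m + k, p * Polynomial.X ^ k + s * Polynomial.X ^ m, ?_⟩
    rw [add_mul, pow_add, ← mul_assoc, h1, ← pow_add, add_comm m k, pow_add, ← mul_assoc, h2]
    simp

/-- Homs out of the Jacobson algebra. -/
def Jlift {A : Type*} [Ring A] [Algebra K A] (x y : A) (h : x * y = 1) : Jacobson K →ₐ[K] A :=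
  RingQuot.liftAlgHom K ⟨FreeAlgebra.lift K ![x, y], by
    rintro _ _ ⟨⟩
    simp [h]⟩

theorem Jlift_x {A : Type*} [Ring A] [Algebra K A] (x y : A) (h : x * y = 1) :
    Jlift K x y h (Xg K) = x := by
  simp [Jlift, Xg]

theorem Jlift_y {A : Type*} [Ring A] [Algebra K A] (x y : A) (h : x * y = 1) :
    Jlift K x y h (Yg K) = y := by
  simp [Jlift, Yg]

theorem Y_transc (p : Polynomial K) (h : Polynomial.aeval (Yg K) p = 0) : p = 0 := by
  have h0 : (RatFunc.X : RatFunc K) ≠ 0 := RatFunc.X_ne_zero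
  have := congrArg (Jlift K (RatFunc.X : RatFunc K)⁻¹ RatFunc.X (inv_mul_cancel₀ h0)) h
  rw [← Polynomial.aeval_algHom_apply, Jlift_y, map_zero] at this
  rw [← RatFunc.algebraMap_X, Polynomial.aeval_algebraMap_apply, Polynomial.aeval_X_left_apply] at this
  exact (map_eq_zero_iff _ (RatFunc.algebraMap_injective K)).1 this

theorem right_inj (f : Polynomial K) (hf : f.eval 0 = -1) (q : Jacobson K)
    (h : q * Polynomial.aeval (cJ K) f = 0) : q = 0 := by
  obtain ⟨g, hfg, hg⟩ := split_f K f hf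
  have hw : q * (cJ K * Polynomial.aeval (cJ K) g) = q := by
    rw [hg, mul_sub, mul_one] at h
    exact sub_eq_zero.1 h
  have hk : ∀ k : ℕ, q * Polynomial.aeval (cJ K) ((Polynomial.X * g) ^ k) = q := by
    intro k
    induction k with
    | zero => simp
    | succ k ih =>
      rw [pow_succ, map_mul, ← mul_assoc, ih]
      simpa using hw
  -- any polynomial in `c` divisible by `c` has the form `y p(y) y x`
  have hcp : ∀ p : Polynomial K, Polynomial.aeval (cJ K) (Polynomial.X * p) =
      Polynomial.aeval (Yg K) (Polynomial.X * Polynomial.X * p) * Xg K := by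
    intro p
    have e : Polynomial.aeval (cJ K) (Polynomial.X * p) =
      Polynomial.aeval (cJ K) p * Yg K * Yg K * Xg K := by
      rw [mul_comm, map_mul, Polynomial.aeval_X]
      have e3 : cJ K = Yg K * Yg K * Xg K := by rw [cJ, sq]
      rw [mul_assoc _ (Yg K) (Yg K), mul_assoc _ (Yg K * Yg K), ← e3]
    rw [e, pc_y]
    have e2 : (Polynomial.X * Polynomial.X * p : Polynomial K) = Polynomial.X * p * Polynomial.X := by ring
    rw [e2]; simp
  obtain ⟨m, s, hs⟩ := exists_Ym K q
  obtain ⟨P, hP⟩ : ∃ P : Polynomial K, q = Polynomial.aeval (Yg K) P * Xg K := by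
    have h1 := hk (m + 1)
    have e : (Polynomial.X * g) ^ (m + 1) = Polynomial.X * (Polynomial.X ^ m * g ^ (m+1)) := by ring
    rw [e, hcp] at h1
    have e2 : Polynomial.X * Polynomial.X * (Polynomial.X ^ m * g ^ (m+1)) =
      Polynomial.X ^ m * (Polynomial.X * Polynomial.X * g ^ (m+1)) := by ring
    rw [e2, map_mul, map_pow, Polynomial.aeval_X, ← mul_assoc, ← mul_assoc, hs, ← map_mul] at h1
    exact ⟨_, h1.symm⟩
  have hz : Polynomial.aeval (Yg K) (P * f) = 0 := by
    have h1 := hk 1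
    rw [pow_one, hcp, hP, mul_assoc Polynomial.X, map_mul, Polynomial.aeval_X] at h1
    have h2 := congrArg (· * Yg K) h1
    simp only [mul_assoc, xy_eq, mul_one] at h2
    rw [← mul_assoc (Xg K), xy_eq, one_mul] at h2
    rw [hfg, mul_sub, mul_one, map_sub, map_mul, h2, sub_self]
  have hPf := Y_transc K _ hz
  have hf0 : f ≠ 0 := by rintro rfl; simp at hf
  have : P = 0 := (mul_eq_zero.1 hPf).resolve_right hf0
  rw [hP, this]; simp

theorem mem_Gf (n : ℕ) (p : Polynomial K) (hp : p.degree < n) :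
    Polynomial.aeval (cJ K) p ∈ Gf K n := by
  rw [Polynomial.aeval_eq_sum_range' (n := max n 1)
    (lt_of_lt_of_le (b := max n 1) (by
      by_cases h : p = 0
      · simp [h]
      · exact lt_max_of_lt_left ((Polynomial.natDegree_lt_iff_degree_lt h).2 hp)) le_rfl)]
  refine Submodule.sum_mem _ fun i _ => ?_
  by_cases h : i < n
  · exact Submodule.smul_mem _ _ (Submodule.subset_span ⟨⟨i, h⟩, rfl⟩)
  · rw [Polynomial.coeff_eq_zero_of_degree_lt (lt_of_lt_of_le hp (by exact_mod_cast not_lt.1 h)),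
      zero_smul]
    exact Submodule.zero_mem _

theorem of_mem_Gf (n : ℕ) (r : Jacobson K) (hr : r ∈ Gf K n) :
    ∃ p : Polynomial K, p.degree < n ∧ r = Polynomial.aeval (cJ K) p := by
  have : Gf K n ≤ (Polynomial.degreeLT K n).map (Polynomial.aeval (cJ K)).toLinearMap := by
    refine Submodule.span_le.2 ?_
    rintro _ ⟨i, rfl⟩
    refine ⟨Polynomial.X ^ (i : ℕ), ?_, by simp⟩
    rw [SetLike.mem_coe, Polynomial.mem_degreeLT, Polynomial.degree_X_pow]
    exact_mod_cast i.2
  obtain ⟨p, hp, rfl⟩ := this hr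
  exact ⟨p, Polynomial.mem_degreeLT.1 hp, rfl⟩

theorem inter_zero (f : Polynomial K) (hf : f.eval 0 = -1) (q r : Jacobson K)
    (hr : r ∈ Gf K f.natDegree) (h : q * Polynomial.aeval (cJ K) f = r) : r = 0 := by
  obtain ⟨p, hp, rfl⟩ := of_mem_Gf K _ r hr
  have hf0 : f ≠ 0 := by rintro rfl; simp at hf
  obtain ⟨g, hfg, -⟩ := split_f K f hf
  have hxy : AdjoinRoot.mk f g * AdjoinRoot.root f = 1 := by
    have : AdjoinRoot.mk f (Polynomial.X * g - 1) = 0 :=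
      AdjoinRoot.mk_eq_zero.2 (dvd_of_eq hfg)
    rw [map_sub, map_mul, map_one, AdjoinRoot.mk_X, mul_comm] at this
    exact sub_eq_zero.1 this
  have hc : Jlift K _ _ hxy (cJ K) = AdjoinRoot.root f := by
    rw [cJ, map_mul, map_pow, Jlift_x, Jlift_y, sq, mul_assoc, mul_comm (AdjoinRoot.root f) (_ * _),
      mul_comm (AdjoinRoot.root f) (AdjoinRoot.mk f g), hxy, one_mul]
  have h2 := congrArg (Jlift K _ _ hxy) h
  rw [map_mul, ← Polynomial.aeval_algHom_apply, ← Polynomial.aeval_algHom_apply, hc,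
    AdjoinRoot.aeval_eq, AdjoinRoot.aeval_eq, AdjoinRoot.mk_self, mul_zero] at h2
  have hd : f ∣ p := AdjoinRoot.mk_eq_zero.1 h2.symm
  rw [← Polynomial.degree_eq_natDegree hf0] at hp
  rw [Polynomial.eq_zero_of_dvd_of_degree_lt hd hp, map_zero]

/-- Division algorithm by `f(c)`: for every irreducible `f ∈ K[x]` with `f(0) = -1` and
every `β` in the Jacobson algebra `R`, there are a unique `q ∈ R` and a unique
`r ∈ G^f` (the `K`-span of `{c^i : 0 ≤ i ≤ natDegree f - 1}`) with `β = q * f(c) + r`. -/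
theorem division_algorithm_by_fc (f : Polynomial K) (hf : f ∈ FSet K) (β : Jacobson K) :
    ∃ q r : Jacobson K, r ∈ Gf K f.natDegree ∧ β = q * Polynomial.aeval (cJ K) f + r ∧
      ∀ q' r' : Jacobson K, r' ∈ Gf K f.natDegree →
        β = q' * Polynomial.aeval (cJ K) f + r' → q' = q ∧ r' = r := by
  obtain ⟨-, hf⟩ := hf
  have hf0 : f ≠ 0 := by rintro rfl; simp at hf
  obtain ⟨q, p, hb⟩ := MM_top K f hf β
  have hp : Polynomial.aeval (cJ K) p = Polynomial.aeval (cJ K) (p / f) *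
      Polynomial.aeval (cJ K) f + Polynomial.aeval (cJ K) (p % f) := by
    rw [← map_mul, ← map_add, mul_comm, EuclideanDomain.div_add_mod]
  have hr : Polynomial.aeval (cJ K) (p % f) ∈ Gf K f.natDegree := by
    apply mem_Gf
    rw [← Polynomial.degree_eq_natDegree hf0]
    exact EuclideanDomain.mod_lt p hf0
  have hb' : β = (q + Polynomial.aeval (cJ K) (p / f)) * Polynomial.aeval (cJ K) f +
      Polynomial.aeval (cJ K) (p % f) := by
    rw [hb, hp, add_mul, add_assoc]
  refine ⟨_, _, hr, hb', ?_⟩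
  intro q' r' hr' h
  have e : (q' - (q + Polynomial.aeval (cJ K) (p / f))) * Polynomial.aeval (cJ K) f =
      Polynomial.aeval (cJ K) (p % f) - r' := by
    rw [sub_mul, sub_eq_sub_iff_add_eq_add, ← h, hb']
    abel
  have e0 := inter_zero K f hf _ _ (Submodule.sub_mem _ hr hr') e
  rw [e0] at e
  exact ⟨sub_eq_zero.1 (right_inj K f hf _ e), (sub_eq_zero.1 e0).symm⟩
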